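/- For every polynomial r with real coefficients satisfying ∫_ℝ r(x)·exp(−x²/2) dx = 0, there is a polynomial h(r) given explicitly as follows: writing r = Σ_{i=1}^N a_i·(Xⁱ − mᵢ) (which is possible, with unique coefficients aᵢ), set h(r) = Σ_{i=1}^N a_i·qᵢ where qᵢ = −Σ_{j=1}^{⌈i/2⌉} ((i−1)!!/(i+1−2j)!!)·X^{i+1−2j}. Then h(r)' − X·h(r) = r. In particular the operator D(q) = q' − X·q admits an explicit linear section on the kernel of the Gaussian expectation. -/

import Mathlib

open Polynomial MeasureTheory Nat

/-- The `i`-th Gaussian moment `mᵢ = (i−1)‼` for `i` even, `0` for `i` odd. -/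
noncomputable def gaussianMoment (i : ℕ) : ℝ := if Even i then ((i - 1)‼ : ℝ) else 0

/-- The explicit primitive `qᵢ = −Σ_{j=1}^{⌈i/2⌉} ((i−1)‼/(i+1−2j)‼)·X^(i+1−2j)`. -/
noncomputable def homotopyGaussianQ (i : ℕ) : Polynomial ℝ :=
  -(∑ j ∈ Finset.Icc 1 ((i + 1) / 2),
      C (((i - 1)‼ : ℝ) / ((i + 1 - 2 * j)‼ : ℝ)) * X ^ (i + 1 - 2 * j))

theorem homotopyGaussianQ_add_two (i : ℕ) :
    homotopyGaussianQ (i + 2) = C ((i : ℝ) + 1) * homotopyGaussianQ i - X ^ (i + 1) := by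
  have h_fact : (i + 1)‼ = (i + 1) * (i - 1)‼ := by
    rcases i with _ | i
    · rfl
    · exact doubleFactorial_add_two i
  have h_shift : ∀ n : ℕ, ∀ f : ℕ → Polynomial ℝ,
      ∑ j ∈ Finset.Icc 1 n, f j = ∑ j ∈ Finset.range n, f (j + 1) := by
    intro n f
    rw [Finset.range_eq_Ico, Finset.sum_Ico_add' f 0 n 1]
    rfl
  unfold homotopyGaussianQ
  rw [h_shift, h_shift, show (i + 2 + 1) / 2 = (i + 1) / 2 + 1 by omega, Finset.sum_range_succ']
  have h_first : C ((((i + 2 - 1)‼ : ℕ) : ℝ) / (((i + 2 + 1 - 2 * (0 + 1))‼ : ℕ) : ℝ)) *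
      X ^ (i + 2 + 1 - 2 * (0 + 1)) = (X ^ (i + 1) : Polynomial ℝ) := by
    rw [show i + 2 - 1 = i + 1 by omega, show i + 2 + 1 - 2 * (0 + 1) = i + 1 by omega,
      div_self (by exact_mod_cast (doubleFactorial_pos _).ne'), C_1, one_mul]
  rw [h_first, mul_neg, Finset.mul_sum, neg_add, ← sub_eq_add_neg]
  congr 2
  refine Finset.sum_congr rfl fun j _ => ?_
  rw [show i + 2 - 1 = i + 1 by omega,
    show i + 2 + 1 - 2 * (j + 1 + 1) = i + 1 - 2 * (j + 1) by omega, h_fact, ← mul_assoc, ← C_mul]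
  push_cast
  rw [mul_div_assoc]

theorem gaussianMoment_add_two (i : ℕ) :
    gaussianMoment (i + 2) = ((i : ℝ) + 1) * gaussianMoment i := by
  unfold gaussianMoment
  rcases i with _ | i
  · simp
  · simp only [Nat.even_add, even_two, iff_true]
    split_ifs
    · rw [show i + 1 + 2 - 1 = i + 2 by omega, doubleFactorial_add_two]
      push_cast
      ring
    · simp

theorem derivative_homotopyGaussianQ_sub (i : ℕ) :
    derivative (homotopyGaussianQ i) - X * homotopyGaussianQ i =
      X ^ i - C (gaussianMoment i) := by
  induction i using Nat.twoStepInduction with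
  | zero => simp [homotopyGaussianQ, gaussianMoment]
  | one => simp [homotopyGaussianQ, gaussianMoment]
  | more i ih _ =>
    rw [homotopyGaussianQ_add_two, gaussianMoment_add_two]
    simp only [derivative_sub, derivative_C_mul, derivative_X_pow, C_mul, Nat.add_sub_cancel]
    push_cast
    simp only [C_add, C_1] at *
    linear_combination (C (i : ℝ) + 1) * ih

theorem derivative_sum_homotopyGaussianQ_sub (a : ℕ →₀ ℝ) :
    derivative (a.sum fun i c => C c * homotopyGaussianQ i) -
        X * (a.sum fun i c => C c * homotopyGaussianQ i) =
      a.sum fun i c => C c * (X ^ i - C (gaussianMoment i)) := by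
  simp only [Finsupp.sum, derivative_sum, Finset.mul_sum, ← Finset.sum_sub_distrib,
    derivative_C_mul, ← derivative_homotopyGaussianQ_sub]
  exact Finset.sum_congr rfl fun i _ => by ring

theorem integrable_eval_mul_gaussian (p : Polynomial ℝ) :
    Integrable fun x : ℝ => p.eval x * Real.exp (-x ^ 2 / 2) := by
  induction p using Polynomial.induction_on' with
  | add p q hp hq => simpa only [eval_add, add_mul] using! hp.add hq
  | monomial n c =>
    have h := (integrable_rpow_mul_exp_neg_mul_sq (b := 1 / 2) (by norm_num)
      (s := n) (by linarith [n.cast_nonneg (α := ℝ)])).const_mul c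
    refine h.congr (Filter.Eventually.of_forall fun x => ?_)
    simp only [eval_monomial, Real.rpow_natCast, mul_assoc]
    ring_nf

theorem integral_derivative_sub_X_mul_gaussian (q : Polynomial ℝ) :
    ∫ x : ℝ, (derivative q - X * q).eval x * Real.exp (-x ^ 2 / 2) = 0 := by
  refine integral_eq_zero_of_hasDerivAt_of_integrable
    (f := fun x => q.eval x * Real.exp (-x ^ 2 / 2)) (fun x => ?_)
    (integrable_eval_mul_gaussian _) (integrable_eval_mul_gaussian q)
  have h_exp : HasDerivAt (fun x : ℝ => Real.exp (-x ^ 2 / 2)) (Real.exp (-x ^ 2 / 2) * -x) x := by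
    have h := ((hasDerivAt_pow 2 x).fun_neg.div_const 2).exp
    convert h using 2
    norm_num
    ring
  refine ((q.hasDerivAt x).fun_mul h_exp).congr_deriv ?_
  simp only [eval_sub, eval_mul, eval_X]
  ring

theorem eq_zero_of_integral_const_mul_gaussian {c : ℝ}
    (h : ∫ x : ℝ, (C c).eval x * Real.exp (-x ^ 2 / 2) = 0) : c = 0 := by
  have h_int : ∫ x : ℝ, Real.exp (-x ^ 2 / 2) = √(Real.pi / (1 / 2)) := by
    rw [← integral_gaussian]
    congr 1 with x
    ring_nf
  simp only [eval_C, integral_const_mul, h_int] at h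
  exact (mul_eq_zero.mp h).resolve_right (by positivity)

theorem coeff_sum_C_mul_X_pow_sub_C (a : ℕ →₀ ℝ) (m : ℕ → ℝ) {n : ℕ} (hn : n ≠ 0) :
    (a.sum fun i c => C c * (X ^ i - C (m i))).coeff n = a n := by
  simp only [Finsupp.sum, finsetSum_coeff, coeff_C_mul, coeff_sub, coeff_X_pow, coeff_C_of_ne_zero hn]
  simp +contextual [eq_comm]

/-- Explicit section of the homotopy Gaussian differential on the kernel of the
Gaussian expectation: any polynomial `r` with vanishing Gaussian expectation can be
written (with unique coefficients) as `r = Σ_{i=1}^{N} aᵢ·(Xⁱ − mᵢ)` where `N = deg r`,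
and for any such representation the polynomial `h(r) = Σ aᵢ·qᵢ` satisfies
`h(r)' − X·h(r) = r`. -/
theorem explicit_homotopy_section (r : Polynomial ℝ)
    (hr : (∫ x : ℝ, r.eval x * Real.exp (-x ^ 2 / 2)) = 0) :
    (∃! a : ℕ →₀ ℝ, (∀ i ∈ a.support, 1 ≤ i ∧ i ≤ r.natDegree) ∧
        r = a.sum fun i c => C c * (X ^ i - C (gaussianMoment i))) ∧
      ∀ a : ℕ →₀ ℝ, (∀ i ∈ a.support, 1 ≤ i) →
        r = (a.sum fun i c => C c * (X ^ i - C (gaussianMoment i))) →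
        derivative (a.sum fun i c => C c * homotopyGaussianQ i) -
            X * (a.sum fun i c => C c * homotopyGaussianQ i) = r := by
  refine ⟨?_, fun a _ ha => (derivative_sum_homotopyGaussianQ_sub a).trans ha.symm⟩
  let a : ℕ →₀ ℝ := Finsupp.onFinset (r.support.erase 0) (fun i => if i = 0 then 0 else r.coeff i)
    (by intro i; by_cases hi : i = 0 <;> simp [hi])
  have h_apply : ∀ i, a i = if i = 0 then 0 else r.coeff i := fun i => rfl
  refine ⟨a, ⟨fun i hi => ?_, ?_⟩, ?_⟩
  · rw [Finsupp.mem_support_iff, h_apply] at hi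
    split_ifs at hi with h0
    · exact absurd rfl hi
    · exact ⟨Nat.one_le_iff_ne_zero.mpr h0, le_natDegree_of_ne_zero hi⟩
  · set s := a.sum fun i c => C c * (X ^ i - C (gaussianMoment i)) with hs
    have h_const : r - s = C ((r - s).coeff 0) := by
      ext n
      rcases eq_or_ne n 0 with rfl | hn
      · simp
      · rw [coeff_C_of_ne_zero hn, coeff_sub, coeff_sum_C_mul_X_pow_sub_C a _ hn, h_apply, if_neg hn,
          sub_self]
    have h_int : ∫ x : ℝ, s.eval x * Real.exp (-x ^ 2 / 2) = 0 := by
      rw [hs, ← derivative_sum_homotopyGaussianQ_sub]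
      exact integral_derivative_sub_X_mul_gaussian _
    have h_zero : (r - s).coeff 0 = 0 := by
      apply eq_zero_of_integral_const_mul_gaussian
      rw [← h_const]
      simp only [eval_sub, sub_mul]
      rw [integral_sub (integrable_eval_mul_gaussian r) (integrable_eval_mul_gaussian s), hr, h_int,
        sub_self]
    rw [h_zero, C_0] at h_const
    exact sub_eq_zero.mp h_const
  · rintro b ⟨hb, hb_sum⟩
    ext n
    rw [h_apply]
    split_ifs with hn
    · by_contra hne
      have := (hb n (Finsupp.mem_support_iff.mpr hne)).1
      omega
    · rw [hb_sum, coeff_sum_C_mul_X_pow_sub_C b _ hn]
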